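/- arXiv:1805.04505 — 6 statements merged into one kernel-verified Lean document; each statement's English description precedes it below -/
import Mathlib

section
/- For every integer k ≥ 0 there exists a real polynomial q such that for all r > 0 one has Q_k(r) = (r-1)^{k+1} · q(r), and moreover q(1) = 2^k/(k+1). (In particular, the function Q_k agrees with a polynomial in r divisible by (r-1)^{k+1}.) -/
open Real Filter Set

/-- `Q k r = r * ∫_1^r t⁻²(t²-1)^k dt`. -/
noncomputable def Q (k : ℕ) (r : ℝ) : ℝ :=
  r * ∫ t in (1:ℝ)..r, (t ^ 2 - 1) ^ k / t ^ 2

open Polynomial in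
/-- The Euler-type equation `X p' - p = h(X²)` has a polynomial solution. -/
theorem exists_X_mul_derivative_sub_eq_comp_sq (h : ℝ[X]) :
    ∃ p : ℝ[X], X * derivative p - p = h.comp (X ^ 2) := by
  induction h using Polynomial.induction_on' with
  | add h₁ h₂ ih₁ ih₂ =>
    obtain ⟨p₁, hp₁⟩ := ih₁
    obtain ⟨p₂, hp₂⟩ := ih₂
    refine ⟨p₁ + p₂, ?_⟩
    rw [add_comp, ← hp₁, ← hp₂, derivative_add]
    ring
  | monomial n a =>
    have hn : (2 * (n : ℝ) - 1) ≠ 0 := by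
      intro h
      have h' : (2 * n : ℝ) = 1 := by linarith
      have : 2 * n = 1 := by exact_mod_cast h'
      omega
    refine ⟨C (a / (2 * n - 1)) * X ^ (2 * n), ?_⟩
    have hX : (X : ℝ[X]) * derivative (X ^ (2 * n)) = C (2 * n : ℝ) * X ^ (2 * n) := by
      rcases n with _ | n
      · simp
      · rw [derivative_X_pow, mul_left_comm, ← pow_succ']
        congr 2
        push_cast
        rfl
    have ha : (C a : ℝ[X]) = C (a / (2 * n - 1)) * (C (2 * n : ℝ) - 1) := by
      rw [← C_1, ← C_sub, ← C_mul, div_mul_cancel₀ _ hn]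
    rw [monomial_comp, ← pow_mul, derivative_C_mul, mul_left_comm, hX, ha]
    ring

open Polynomial in
/-- A polynomial vanishing at `1` with `X p' - p = (X - 1)^k g` and `g(1) ≠ 0` is divisible by
`(X - 1)^(k + 1)`, with quotient of value `g(1) / (k + 1)` at `1`. -/
theorem exists_eq_pow_mul_of_X_mul_derivative_sub {p g : ℝ[X]} {k : ℕ}
    (h : X * derivative p - p = (X - C 1) ^ k * g) (hp : p.eval 1 = 0) (hg : g.eval 1 ≠ 0) :
    ∃ q : ℝ[X], p = (X - C 1) ^ (k + 1) * q ∧ q.eval 1 = g.eval 1 / (k + 1) := by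
  have hX : (X - C 1 : ℝ[X]) ≠ 0 := X_sub_C_ne_zero 1
  have hp0 : p ≠ 0 := by
    rintro rfl
    have hg0 : g ≠ 0 := by
      rintro rfl
      simp at hg
    simp only [derivative_zero, mul_zero, sub_zero] at h
    exact mul_ne_zero (pow_ne_zero k hX) hg0 h.symm
  obtain ⟨q, hq, hqd⟩ := exists_eq_pow_rootMultiplicity_mul_and_not_dvd p hp0 1
  have hq1 : q.eval 1 ≠ 0 := fun h0 => hqd (dvd_iff_isRoot.2 h0)
  obtain ⟨n, hn⟩ : ∃ n, p.rootMultiplicity 1 = n + 1 :=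
    Nat.exists_eq_succ_of_ne_zero ((rootMultiplicity_pos hp0).2 hp).ne'
  rw [hn] at hq
  set A : ℝ[X] := C (n + 1 : ℝ) * X * q + (X - C 1) * (X * derivative q - q) with hA
  have hA1 : A.eval 1 = (n + 1) * q.eval 1 := by simp [hA]
  have hn1 : (n + 1 : ℝ) ≠ 0 := by positivity
  have hA0 : A.eval 1 ≠ 0 := hA1 ▸ mul_ne_zero hn1 hq1
  have hAg : (X - C 1) ^ n * A = (X - C 1) ^ k * g := by
    rw [← h, hq, derivative_mul, derivative_X_sub_C_pow, hA, Nat.add_sub_cancel]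
    push_cast
    simp only [map_add, map_natCast, map_one]
    ring
  have hnk : n = k := by
    rcases lt_trichotomy n k with hlt | heq | hlt
    · obtain ⟨d, rfl⟩ := Nat.exists_eq_add_of_lt hlt
      rw [add_assoc, pow_add, mul_assoc] at hAg
      rw [mul_left_cancel₀ (pow_ne_zero n hX) hAg] at hA0
      simp at hA0
    · exact heq
    · obtain ⟨d, rfl⟩ := Nat.exists_eq_add_of_lt hlt
      rw [add_assoc, pow_add, mul_assoc] at hAg
      rw [← mul_left_cancel₀ (pow_ne_zero k hX) hAg] at hg
      simp at hg
  subst hnk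
  refine ⟨q, hq, ?_⟩
  rw [← mul_left_cancel₀ (pow_ne_zero n hX) hAg, hA1, mul_div_cancel_left₀ _ hn1]

open Polynomial in
/-- A polynomial solution of `X p' - p = (X² - 1)^k` vanishing at `1` represents `Q k`. -/
theorem Q_eq_eval {p : ℝ[X]} {k : ℕ} (h : X * derivative p - p = (X ^ 2 - 1) ^ k)
    (hp : p.eval 1 = 0) {r : ℝ} (hr : 0 < r) : Q k r = p.eval r := by
  have hpos : ∀ t ∈ uIcc 1 r, t ≠ 0 := fun t ht =>
    ((lt_min one_pos hr).trans_le ht.1).ne'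
  have hd : ∀ t ∈ uIcc 1 r,
      HasDerivAt (fun t => p.eval t / t) ((t ^ 2 - 1) ^ k / t ^ 2) t := by
    intro t ht
    have := congrArg (eval t) h
    simp only [eval_sub, eval_mul, eval_X, eval_pow, eval_one] at this
    have hdiv := (p.hasDerivAt t).fun_div (hasDerivAt_id' t) (hpos t ht)
    rwa [mul_one, mul_comm _ t, this] at hdiv
  have hc : ContinuousOn (fun t : ℝ => (t ^ 2 - 1) ^ k / t ^ 2) (uIcc 1 r) :=
    ContinuousOn.div (by fun_prop) (by fun_prop) fun t ht => pow_ne_zero 2 (hpos t ht)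
  rw [Q, intervalIntegral.integral_eq_sub_of_hasDerivAt hd hc.intervalIntegrable, hp, zero_div,
    sub_zero, mul_div_cancel₀ _ hr.ne']

/-- `Q_k` agrees (on `(0,∞)`) with a polynomial divisible by `(r-1)^(k+1)`,
whose quotient evaluates at `1` to `2^k/(k+1)`. -/
theorem stmt_0 (k : ℕ) :
    ∃ q : Polynomial ℝ,
      (∀ r : ℝ, 0 < r → Q k r = (r - 1) ^ (k + 1) * q.eval r) ∧
      q.eval 1 = 2 ^ k / (k + 1) := by
  open Polynomial in
  obtain ⟨p₀, hp₀⟩ := exists_X_mul_derivative_sub_eq_comp_sq ((X - 1) ^ k)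
  let p : ℝ[X] := p₀ - C (p₀.eval 1) * X
  have hp : X * derivative p - p = (X ^ 2 - 1) ^ k := by
    have hcomp : ((X - 1 : ℝ[X]) ^ k).comp (X ^ 2) = (X ^ 2 - 1) ^ k := by simp
    rw [← hcomp, ← hp₀]
    simp only [p, derivative_sub, derivative_C_mul, derivative_X]
    ring
  have hp1 : p.eval 1 = 0 := by simp [p]
  have hfac : X * derivative p - p = (X - C 1) ^ k * (X + 1) ^ k := by
    rw [hp, ← mul_pow, C_1]
    ring
  have hg : ((X + 1 : ℝ[X]) ^ k).eval 1 = 2 ^ k := by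
    simp [one_add_one_eq_two]
  obtain ⟨q, hq, hq1⟩ := exists_eq_pow_mul_of_X_mul_derivative_sub hfac hp1
    (by rw [hg]; positivity)
  refine ⟨q, fun r hr => ?_, by rw [hq1, hg]⟩
  rw [Q_eq_eval hp hp1 hr, hq]
  simp
end

section
/- For every integer n ≥ 1 and every real r > 0, one has (2n-1)·Q_n(r) + 2n·Q_{n-1}(r) = (r²-1)^n. (Thus for the parameter value c = 1 the polynomial P_n = (2n-1)Q_n + 2nc^{-1}Q_{n-1} equals (r²-1)^n, which gives the hyperbolic metric.) -/
open Real Filter Set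

theorem intervalIntegrable_sq_sub_one_pow_div_sq (k : ℕ) {a b : ℝ} (ha : 0 < a) (hb : 0 < b) :
    IntervalIntegrable (fun t : ℝ => (t ^ 2 - 1) ^ k / t ^ 2) MeasureTheory.volume a b := by
  refine ContinuousOn.intervalIntegrable (ContinuousOn.div (by fun_prop) (by fun_prop) ?_)
  intro t ht
  have ht0 : 0 < t := (lt_min ha hb).trans_le ht.1
  positivity

theorem hasDerivAt_sq_sub_one_pow_succ_div (m : ℕ) {t : ℝ} (ht : t ≠ 0) :
    HasDerivAt (fun t : ℝ => (t ^ 2 - 1) ^ (m + 1) / t)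
      ((2 * (m : ℝ) + 1) * ((t ^ 2 - 1) ^ (m + 1) / t ^ 2) +
        2 * ((m : ℝ) + 1) * ((t ^ 2 - 1) ^ m / t ^ 2)) t := by
  have h := ((((hasDerivAt_id' t).pow 2).sub_const 1).pow (m + 1)).div (hasDerivAt_id' t) ht
  refine h.congr_deriv ?_
  simp only [Pi.pow_apply, Nat.add_sub_cancel]
  push_cast
  field_simp
  ring

/-- For `n ≥ 1`: `(2n-1)Q_n + 2nQ_{n-1} = (r²-1)^n`, i.e. `P_n = (r²-1)^n` when `c = 1`. -/
theorem stmt_5 (n : ℕ) (hn : 1 ≤ n) (r : ℝ) (hr : 0 < r) :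
    (2 * (n : ℝ) - 1) * Q n r + 2 * (n : ℝ) * Q (n - 1) r = (r ^ 2 - 1) ^ n := by
  obtain ⟨m, rfl⟩ := Nat.exists_eq_add_of_le' hn
  have hi (k : ℕ) := intervalIntegrable_sq_sub_one_pow_div_sq k one_pos hr
  have h := intervalIntegral.integral_eq_sub_of_hasDerivAt
    (fun t ht => hasDerivAt_sq_sub_one_pow_succ_div m
      ((lt_min one_pos hr).trans_le ht.1).ne')
    (((hi (m + 1)).const_mul (2 * (m : ℝ) + 1)).add ((hi m).const_mul (2 * ((m : ℝ) + 1))))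
  rw [intervalIntegral.integral_add ((hi _).const_mul _) ((hi _).const_mul _),
    intervalIntegral.integral_const_mul, intervalIntegral.integral_const_mul] at h
  simp only [one_pow, sub_self, ne_eq, Nat.succ_ne_zero, not_false_eq_true, zero_pow, zero_div,
    sub_zero] at h
  rw [eq_div_iff hr.ne'] at h
  simp only [Q, Nat.add_sub_cancel]
  push_cast
  linear_combination h
end

section
/- Let n ≥ 2 be an integer, c > 0, λ and Λ real numbers, and let I ⊆ (1,∞) be an open interval. Let P : I → ℝ be a differentiable function with P(r) > 0 on I, and define β : I → ℝ by β(r) = c·(r²-1)^{(1-n)/2}·√(P(r)). Then for every r ∈ I the equation -β(r)² - (2n-3)r²β(r)² - 2r(r²-1)β(r)β'(r) + λc(r²-1) = Λc²(r²-1)² holds if and only if the derivative of the function r ↦ r^{-1}P(r) at r equals λc^{-1}r^{-2}(r²-1)^{n-1} - Λr^{-2}(r²-1)^n. -/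
open Real Filter Set

/-- The square of `cu^(-m/2)√p`, in terms of natural powers. -/
theorem sq_mul_rpow_half_mul_sqrt (m : ℕ) (c : ℝ) {u p : ℝ} (hu : 0 < u) (hp : 0 ≤ p) :
    (c * u ^ ((1 - ((m + 1 : ℕ) : ℝ)) / 2) * √p) ^ 2 = c ^ 2 * p / u ^ m := by
  have h : (u ^ ((1 - ((m + 1 : ℕ) : ℝ)) / 2)) ^ 2 = (u ^ m)⁻¹ := by
    rw [← rpow_natCast, ← rpow_mul hu.le, ← rpow_natCast u m, ← rpow_neg hu.le]
    congr 1
    push_cast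
    ring
  rw [mul_pow, mul_pow, h, sq_sqrt hp]
  ring

/-- In the Page–Pope construction, with `β = c(r²-1)^((1-n)/2)√P` on an open interval
`I = (a,b) ⊆ (1,∞)`, the Einstein equation component
`-β² - (2n-3)r²β² - 2r(r²-1)ββ' + λc(r²-1) = Λc²(r²-1)²` holds at `r ∈ I`
iff `(r⁻¹P)'(r) = λc⁻¹r⁻²(r²-1)^(n-1) - Λr⁻²(r²-1)^n`. -/
theorem stmt_7 (n : ℕ) (hn : 2 ≤ n) (c lam Lam : ℝ) (hc : 0 < c)
    (a b : ℝ) (hI : Set.Ioo a b ⊆ Set.Ioi (1 : ℝ))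
    (P : ℝ → ℝ) (hP : ∀ r ∈ Set.Ioo a b, DifferentiableAt ℝ P r)
    (hPpos : ∀ r ∈ Set.Ioo a b, 0 < P r)
    (β : ℝ → ℝ)
    (hβ : ∀ r ∈ Set.Ioo a b,
      β r = c * (r ^ 2 - 1) ^ ((1 - (n : ℝ)) / 2) * Real.sqrt (P r))
    (r : ℝ) (hr : r ∈ Set.Ioo a b) :
    (-(β r) ^ 2 - (2 * (n : ℝ) - 3) * r ^ 2 * (β r) ^ 2
        - 2 * r * (r ^ 2 - 1) * β r * deriv β r + lam * c * (r ^ 2 - 1)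
      = Lam * c ^ 2 * (r ^ 2 - 1) ^ 2)
    ↔ deriv (fun s => s⁻¹ * P s) r
        = lam * c⁻¹ * r ^ (-2 : ℤ) * (r ^ 2 - 1) ^ (n - 1)
          - Lam * r ^ (-2 : ℤ) * (r ^ 2 - 1) ^ n := by
  obtain ⟨m, rfl⟩ : ∃ m, n = m + 1 := ⟨n - 1, by lia⟩
  have h_pos : ∀ s ∈ Set.Ioo a b, 0 < s ^ 2 - 1 := fun s hs => by
    have : 1 < s := hI hs
    nlinarith
  have hu := h_pos r hr
  have hr0 : 0 < r := one_pos.trans (hI hr)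
  have hnhds : Set.Ioo a b ∈ nhds r := Ioo_mem_nhds hr.1 hr.2
  have hPd := (hP r hr).hasDerivAt
  have hud : HasDerivAt (fun s : ℝ => s ^ 2 - 1) (2 * r) r := by
    simpa using (hasDerivAt_pow 2 r).sub_const 1
  have hβd : DifferentiableAt ℝ β r := by
    have h : DifferentiableAt ℝ
        (fun s => c * (s ^ 2 - 1) ^ ((1 - ((m + 1 : ℕ) : ℝ)) / 2) * √(P s)) r :=
      ((hud.differentiableAt.rpow_const (Or.inl hu.ne')).const_mul c).mul
        ((hP r hr).sqrt (hPpos r hr).ne')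
    exact h.congr_of_eventuallyEq (eventually_of_mem hnhds hβ)
  have hsq : ∀ s ∈ Set.Ioo a b, β s ^ 2 = c ^ 2 * P s / (s ^ 2 - 1) ^ m := fun s hs => by
    rw [hβ s hs, sq_mul_rpow_half_mul_sqrt m c (h_pos s hs) (hPpos s hs).le]
  have hs : β r ^ 2 * (r ^ 2 - 1) ^ m = c ^ 2 * P r := by
    rw [hsq r hr]
    field_simp
  have hββ : 2 * β r * deriv β r * (r ^ 2 - 1) * (r ^ 2 - 1) ^ m
      = c ^ 2 * (deriv P r * (r ^ 2 - 1) - 2 * m * r * P r) := by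
    have h₁ : HasDerivAt (fun s => β s ^ 2 * (s ^ 2 - 1) ^ m) _ r :=
      (hβd.hasDerivAt.pow 2).mul (hud.pow m)
    have h₂ : HasDerivAt (fun s => β s ^ 2 * (s ^ 2 - 1) ^ m) (c ^ 2 * deriv P r) r := by
      refine (hPd.const_mul (c ^ 2)).congr_of_eventuallyEq (eventually_of_mem hnhds ?_)
      intro s hs
      have := (h_pos s hs).ne'
      simp only [hsq s hs]
      field_simp
    have h := h₁.unique h₂
    have hpow : (m : ℝ) * (r ^ 2 - 1) ^ (m - 1) * (r ^ 2 - 1) = m * (r ^ 2 - 1) ^ m := by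
      cases m with
      | zero => simp
      | succ k => simp [pow_succ, mul_assoc]
    simp only [Pi.pow_apply, Nat.cast_ofNat, Nat.add_one_sub_one, pow_one] at h
    linear_combination (r ^ 2 - 1) * h - β r ^ 2 * 2 * r * hpow - 2 * m * r * hs
  have hderiv : deriv (fun s => s⁻¹ * P s) r = (r * deriv P r - P r) / r ^ 2 := by
    refine ((hasDerivAt_inv hr0.ne').mul hPd).deriv.trans ?_
    field_simp
    ring
  rw [hderiv, Nat.add_sub_cancel, ← sub_eq_zero,
    ← sub_eq_zero (a := (r * deriv P r - P r) / r ^ 2)]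
  have key : (-(β r) ^ 2 - (2 * ((m + 1 : ℕ) : ℝ) - 3) * r ^ 2 * (β r) ^ 2
        - 2 * r * (r ^ 2 - 1) * β r * deriv β r + lam * c * (r ^ 2 - 1)
        - Lam * c ^ 2 * (r ^ 2 - 1) ^ 2) * (r ^ 2 - 1) ^ m
      = -(c ^ 2 * r ^ 2 * (r ^ 2 - 1)) * ((r * deriv P r - P r) / r ^ 2
        - (lam * c⁻¹ * r ^ (-2 : ℤ) * (r ^ 2 - 1) ^ m
          - Lam * r ^ (-2 : ℤ) * (r ^ 2 - 1) ^ (m + 1))) := by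
    have hz : r ^ (-2 : ℤ) = (r ^ 2)⁻¹ := by rw [zpow_neg]; norm_cast
    have hrhs : -(c ^ 2 * r ^ 2 * (r ^ 2 - 1)) * ((r * deriv P r - P r) / r ^ 2
        - (lam * c⁻¹ * r ^ (-2 : ℤ) * (r ^ 2 - 1) ^ m
          - Lam * r ^ (-2 : ℤ) * (r ^ 2 - 1) ^ (m + 1)))
        = -(r ^ 2 - 1) * (c ^ 2 * (r * deriv P r - P r) - lam * c * (r ^ 2 - 1) ^ m
          + Lam * c ^ 2 * (r ^ 2 - 1) ^ (m + 1)) := by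
      rw [hz]
      field_simp
      ring
    rw [hrhs]
    push_cast
    linear_combination (-1 - (2 * m - 1) * r ^ 2) * hs - r * hββ
  have hv : (r ^ 2 - 1) ^ m ≠ 0 := (pow_pos hu m).ne'
  have hw : -(c ^ 2 * r ^ 2 * (r ^ 2 - 1)) ≠ 0 := neg_ne_zero.mpr (by positivity)
  rw [← mul_eq_zero_iff_right hv, key, mul_eq_zero_iff_left hw]
end

section
/- Let n ≥ 2 be an integer and c > 0, and define on (1,∞): α(r)² = (r²-1)^{n-1}/P_{n,c}(r), β(r)² = c²(r²-1)^{-n+1}P_{n,c}(r), and γ(r)² = c(r²-1). Then as r → 1⁺: (r-1)·α(r)² tends to c/2, β(r)²/(r-1) tends to 2c, and γ(r)²/(r-1) tends to 2c. -/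
open Real Filter Set

/-- `P_{n,c} = (2n-1)Q_n + (2n/c)Q_{n-1}`. -/
noncomputable def P (n : ℕ) (c r : ℝ) : ℝ :=
  (2 * (n : ℝ) - 1) * Q n r + (2 * (n : ℝ) / c) * Q (n - 1) r

theorem integral_sub_one_pow (k : ℕ) (a r : ℝ) :
    ∫ t in (1:ℝ)..r, a * (t - 1) ^ k = a * ((r - 1) ^ (k + 1) / (k + 1)) := by
  rw [intervalIntegral.integral_const_mul,
    intervalIntegral.integral_comp_sub_right (fun t : ℝ => t ^ k) 1, integral_pow]
  simp

theorem intervalIntegrable_Q_integrand (k : ℕ) {r : ℝ} (hr : 1 < r) :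
    IntervalIntegrable (fun t : ℝ => (t ^ 2 - 1) ^ k / t ^ 2) MeasureTheory.volume 1 r := by
  apply ContinuousOn.intervalIntegrable
  rw [uIcc_of_le hr.le]
  refine ContinuousOn.div (by fun_prop) (by fun_prop) fun t ht => ?_
  have : 0 < t := by linarith [ht.1]
  positivity

theorem le_Q (k : ℕ) {r : ℝ} (hr : 1 < r) :
    r * (2 ^ k / r ^ 2 * ((r - 1) ^ (k + 1) / (k + 1))) ≤ Q k r := by
  unfold Q
  rw [← integral_sub_one_pow]
  gcongr
  refine intervalIntegral.integral_mono_on hr.le (Continuous.intervalIntegrable (by fun_prop) _ _)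
    (intervalIntegrable_Q_integrand k hr) fun t ht => ?_
  obtain ⟨h1, h2⟩ := ht
  have ht1 : 0 ≤ t - 1 := by linarith
  rw [show t ^ 2 - 1 = (t + 1) * (t - 1) by ring, mul_pow, div_mul_eq_mul_div]
  gcongr
  linarith

theorem Q_le (k : ℕ) {r : ℝ} (hr : 1 < r) :
    Q k r ≤ r * ((r + 1) ^ k * ((r - 1) ^ (k + 1) / (k + 1))) := by
  unfold Q
  rw [← integral_sub_one_pow]
  gcongr
  refine intervalIntegral.integral_mono_on hr.le (intervalIntegrable_Q_integrand k hr)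
    (Continuous.intervalIntegrable (by fun_prop) _ _) fun t ht => ?_
  obtain ⟨h1, h2⟩ := ht
  have ht1 : 0 ≤ t - 1 := by linarith
  rw [show t ^ 2 - 1 = (t + 1) * (t - 1) by ring, mul_pow]
  refine (div_le_self (by positivity) (one_le_pow₀ h1)).trans ?_
  gcongr

theorem tendsto_Q_div (k : ℕ) :
    Tendsto (fun r : ℝ => Q k r / ((r ^ 2 - 1) ^ k * (r - 1))) (nhdsWithin 1 (Set.Ioi 1))
      (nhds (1 / ((k : ℝ) + 1))) := by
  have hk : (k : ℝ) + 1 ≠ 0 := by positivity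
  have hlow : Tendsto (fun r : ℝ => (2 / (r + 1)) ^ k / r / ((k : ℝ) + 1)) (nhdsWithin 1 (Set.Ioi 1))
      (nhds (1 / ((k : ℝ) + 1))) := by
    have : ContinuousAt (fun r : ℝ => (2 / (r + 1)) ^ k / r / ((k : ℝ) + 1)) 1 := by
      fun_prop (disch := norm_num)
    have := this.tendsto
    norm_num at this
    simpa using this.mono_left nhdsWithin_le_nhds
  have hupp : Tendsto (fun r : ℝ => r / (k + 1)) (nhdsWithin 1 (Set.Ioi 1))
      (nhds (1 / ((k : ℝ) + 1))) :=
    (tendsto_id.mono_left nhdsWithin_le_nhds).div_const _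
  refine tendsto_of_tendsto_of_tendsto_of_le_of_le' hlow hupp ?_ ?_ <;>
    filter_upwards [self_mem_nhdsWithin] with r hr <;>
    have hr : 1 < r := hr <;>
    have h0 : 0 < r - 1 := sub_pos.2 hr <;>
    have h1 : 0 < r + 1 := by linarith
  · rw [show r ^ 2 - 1 = (r + 1) * (r - 1) by ring, mul_pow, le_div_iff₀ (by positivity)]
    refine le_of_eq_of_le ?_ (le_Q k hr)
    rw [div_pow]
    field_simp
    ring
  · rw [show r ^ 2 - 1 = (r + 1) * (r - 1) by ring, mul_pow, div_le_iff₀ (by positivity)]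
    refine (Q_le k hr).trans_eq ?_
    field_simp
    ring

theorem tendsto_P_div {n : ℕ} (hn : 1 ≤ n) (c : ℝ) :
    Tendsto (fun r : ℝ => P n c r / ((r ^ 2 - 1) ^ (n - 1) * (r - 1)))
      (nhdsWithin 1 (Set.Ioi 1)) (nhds (2 / c)) := by
  obtain ⟨m, rfl⟩ := Nat.exists_eq_add_of_le' hn
  have hsq : Tendsto (fun r : ℝ => r ^ 2 - 1) (nhdsWithin 1 (Set.Ioi 1)) (nhds 0) := by
    have : Continuous fun r : ℝ => r ^ 2 - 1 := by fun_prop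
    simpa using (this.tendsto 1).mono_left nhdsWithin_le_nhds
  have hlim := ((hsq.mul (tendsto_Q_div (m + 1))).const_mul (2 * ((m + 1 : ℕ) : ℝ) - 1)).add
    ((tendsto_Q_div m).const_mul (2 * ((m + 1 : ℕ) : ℝ) / c))
  have hval : (2 * ((m + 1 : ℕ) : ℝ) - 1) * (0 * (1 / ((m + 1 : ℕ) + 1))) +
      2 * ((m + 1 : ℕ) : ℝ) / c * (1 / (m + 1)) = 2 / c := by
    have : (m : ℝ) + 1 ≠ 0 := by positivity
    push_cast
    field_simp
    simp
  rw [hval] at hlim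
  refine hlim.congr' ?_
  filter_upwards [self_mem_nhdsWithin] with r hr
  have h0 : r - 1 ≠ 0 := (sub_pos.2 hr).ne'
  have h1 : r ^ 2 - 1 ≠ 0 := (sub_pos.2 (one_lt_pow₀ hr two_ne_zero)).ne'
  rw [P, Nat.add_sub_cancel, pow_succ (r ^ 2 - 1), add_div, mul_div_assoc _ (Q _ r),
    mul_div_assoc _ (Q m r)]
  congr 2
  field_simp

/-- As `r → 1⁺`: `(r-1)α² → c/2`, `β²/(r-1) → 2c`, `γ²/(r-1) → 2c`, where
`α² = (r²-1)^(n-1)/P_{n,c}`, `β² = c²(r²-1)^(-n+1)P_{n,c}`, `γ² = c(r²-1)`. -/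
theorem stmt_11 (n : ℕ) (hn : 2 ≤ n) (c : ℝ) (hc : 0 < c) :
    Tendsto (fun r : ℝ => (r - 1) * ((r ^ 2 - 1) ^ (n - 1) / P n c r))
      (nhdsWithin 1 (Set.Ioi 1)) (nhds (c / 2)) ∧
    Tendsto (fun r : ℝ => (c ^ 2 * (r ^ 2 - 1) ^ (-(n : ℤ) + 1) * P n c r) / (r - 1))
      (nhdsWithin 1 (Set.Ioi 1)) (nhds (2 * c)) ∧
    Tendsto (fun r : ℝ => (c * (r ^ 2 - 1)) / (r - 1))
      (nhdsWithin 1 (Set.Ioi 1)) (nhds (2 * c)) := by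
  have hP := tendsto_P_div (one_le_two.trans hn) c
  refine ⟨?_, ?_, ?_⟩
  · have hlim := hP.inv₀ (by positivity)
    rw [inv_div] at hlim
    refine hlim.congr fun r => ?_
    rw [inv_div, mul_comm, mul_div_right_comm, mul_comm]
    ring
  · have hlim := hP.const_mul (c ^ 2)
    rw [show c ^ 2 * (2 / c) = 2 * c by field_simp] at hlim
    refine hlim.congr fun r => ?_
    rw [show -(n : ℤ) + 1 = -((n - 1 : ℕ) : ℤ) by omega, zpow_neg, zpow_natCast]
    simp only [div_eq_mul_inv, mul_inv]
    ring
  · have hlim : Tendsto (fun r : ℝ => c * (r + 1)) (nhdsWithin 1 (Set.Ioi 1)) (nhds (2 * c)) := by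
      have : Continuous fun r : ℝ => c * (r + 1) := by fun_prop
      have := (this.tendsto 1).mono_left (nhdsWithin_le_nhds (s := Set.Ioi 1))
      rwa [show c * (1 + 1) = 2 * c by ring] at this
    refine hlim.congr' ?_
    filter_upwards [self_mem_nhdsWithin] with r hr
    have h0 : r - 1 ≠ 0 := (sub_pos.2 hr).ne'
    field_simp
    ring
end

section
/- Let c > 0, set m² = 1/c - 1, and let ρ ∈ (0,1). With r = 1 + 2ρ²/(c(1-ρ²)), one has P_{2,c}(r) = 16c^{-3}·ρ⁴(1 + m²ρ⁴)/(1-ρ²)⁴. (This shows that for n = 2 the constructed family coincides with Pedersen's metrics.) -/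
open Real Filter Set

theorem Q_eq_of_hasDerivAt {k : ℕ} {r : ℝ} (hr : 0 < r) {F : ℝ → ℝ}
    (hF : ∀ t : ℝ, 0 < t → HasDerivAt F ((t ^ 2 - 1) ^ k / t ^ 2) t) :
    Q k r = r * (F r - F 1) := by
  have hpos : ∀ t ∈ Set.uIcc 1 r, 0 < t := fun t ht =>
    lt_of_lt_of_le (lt_min one_pos hr) ht.1
  rw [Q, intervalIntegral.integral_eq_sub_of_hasDerivAt (fun t ht => hF t (hpos t ht))]
  apply ContinuousOn.intervalIntegrable
  exact ContinuousOn.div (by fun_prop) (by fun_prop) fun t ht =>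
    pow_ne_zero 2 (hpos t ht).ne'

theorem Q_one {r : ℝ} (hr : 0 < r) : Q 1 r = (r - 1) ^ 2 := by
  rw [Q_eq_of_hasDerivAt (F := fun t => t + t⁻¹) hr]
  · field_simp
    ring
  · intro t ht
    refine ((hasDerivAt_id' t).add (hasDerivAt_inv ht.ne')).congr_deriv ?_
    field_simp
    ring

theorem three_mul_Q_two {r : ℝ} (hr : 0 < r) : 3 * Q 2 r = (r - 1) ^ 3 * (r + 3) := by
  rw [Q_eq_of_hasDerivAt (F := fun t => t ^ 3 / 3 - 2 * t - t⁻¹) hr]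
  · field_simp
    ring
  · intro t ht
    refine ((((hasDerivAt_pow 3 t).div_const 3).sub ((hasDerivAt_id' t).const_mul 2)).sub
      (hasDerivAt_inv ht.ne')).congr_deriv ?_
    field_simp
    ring

theorem P_two (c : ℝ) {r : ℝ} (hr : 0 < r) :
    P 2 c r = (r - 1) ^ 3 * (r + 3) + 4 / c * (r - 1) ^ 2 := by
  rw [← three_mul_Q_two hr, ← Q_one hr, P]
  norm_num

/-- With `m² = 1/c - 1` and `r = 1 + 2ρ²/(c(1-ρ²))`,
`P_{2,c}(r) = 16c⁻³ρ⁴(1 + m²ρ⁴)/(1-ρ²)⁴`: the family coincides with Pedersen's metrics. -/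
theorem stmt_12 (c : ℝ) (hc : 0 < c) (m2 ρ : ℝ) (hm2 : m2 = 1 / c - 1)
    (hρ : ρ ∈ Set.Ioo (0 : ℝ) 1) :
    P 2 c (1 + 2 * ρ ^ 2 / (c * (1 - ρ ^ 2)))
      = 16 * c ^ (-3 : ℤ) * ρ ^ 4 * (1 + m2 * ρ ^ 4) / (1 - ρ ^ 2) ^ 4 := by
  have hρ' : 0 < 1 - ρ ^ 2 := by nlinarith [hρ.1, hρ.2]
  have hr : 0 < 1 + 2 * ρ ^ 2 / (c * (1 - ρ ^ 2)) := by positivity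
  rw [P_two c hr, hm2, zpow_neg, show (3 : ℤ) = ((3 : ℕ) : ℤ) from rfl, zpow_natCast]
  field_simp
  ring
end

section
/- Let n ≥ 2 be an integer, t > 0 fixed, and b_n = 2n/(2n-3). For c > 0 set r_c = c^{-1/2}t + 1. Then the limit as c → 0⁺ of c^n·P_{n,c}(r_c) equals t^{2n} + b_n·t^{2n-2}. -/
open Real Filter Set

theorem continuousOn_Q_integrand (k : ℕ) {r : ℝ} (hr : 0 < r) :
    ContinuousOn (fun x : ℝ => (x ^ 2 - 1) ^ k / x ^ 2) (uIcc 1 r) := by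
  refine ContinuousOn.div (by fun_prop) (by fun_prop) fun x hx => ?_
  exact pow_ne_zero 2 ((lt_min one_pos hr).trans_le hx.1).ne'

/-- Integration by parts gives a first-order recursion for `Q`. -/
theorem Q_succ_add_Q (k : ℕ) {r : ℝ} (hr : 0 < r) :
    (2 * (k : ℝ) + 1) * Q (k + 1) r + 2 * ((k : ℝ) + 1) * Q k r = (r ^ 2 - 1) ^ (k + 1) := by
  have hf (j : ℕ) : IntervalIntegrable (fun x : ℝ => (x ^ 2 - 1) ^ j / x ^ 2)
      MeasureTheory.volume 1 r :=
    (continuousOn_Q_integrand j hr).intervalIntegrable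
  have hderiv : ∀ x ∈ uIcc 1 r, HasDerivAt (fun x : ℝ => (x ^ 2 - 1) ^ (k + 1) / x)
      ((2 * (k : ℝ) + 1) * ((x ^ 2 - 1) ^ (k + 1) / x ^ 2)
        + 2 * ((k : ℝ) + 1) * ((x ^ 2 - 1) ^ k / x ^ 2)) x := by
    intro x hx
    have hx0 : x ≠ 0 := ((lt_min one_pos hr).trans_le hx.1).ne'
    refine (((((hasDerivAt_id x).pow 2).sub_const 1).pow (k + 1)).div
      (hasDerivAt_id x) hx0).congr_deriv ?_
    simp only [id, Pi.pow_apply, Nat.add_sub_cancel]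
    push_cast
    field_simp
    ring
  have hFTC := intervalIntegral.integral_eq_sub_of_hasDerivAt hderiv
    (((hf (k + 1)).const_mul _).add ((hf k).const_mul _))
  rw [intervalIntegral.integral_add ((hf (k + 1)).const_mul _) ((hf k).const_mul _),
    intervalIntegral.integral_const_mul, intervalIntegral.integral_const_mul] at hFTC
  simp only [one_pow, sub_self, ne_eq, Nat.succ_ne_zero, not_false_eq_true, zero_pow, zero_div,
    sub_zero] at hFTC
  rw [eq_div_iff hr.ne'] at hFTC
  rw [← hFTC, Q, Q]
  ring

theorem Q_zero {r : ℝ} (hr : 0 < r) : Q 0 r = r - 1 := by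
  have hderiv : ∀ x ∈ uIcc 1 r, HasDerivAt (fun x : ℝ => -x⁻¹) ((x ^ 2 - 1) ^ 0 / x ^ 2) x := by
    intro x hx
    have hx0 : x ≠ 0 := ((lt_min one_pos hr).trans_le hx.1).ne'
    exact (hasDerivAt_inv hx0).neg.congr_deriv (by simp)
  rw [Q, intervalIntegral.integral_eq_sub_of_hasDerivAt hderiv
    (continuousOn_Q_integrand 0 hr).intervalIntegrable]
  field_simp
  ring

theorem tendsto_Q_succ_div_pow_of_tendsto (k : ℕ)
    (h : Tendsto (fun r : ℝ => Q k r / r ^ (2 * (k + 1))) atTop (nhds 0)) :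
    Tendsto (fun r : ℝ => Q (k + 1) r / r ^ (2 * (k + 1))) atTop
      (nhds (1 / (2 * (k : ℝ) + 1))) := by
  have hinv : Tendsto (fun r : ℝ => r⁻¹) atTop (nhds 0) := tendsto_inv_atTop_zero
  have hlim := ((((hinv.pow 2).const_sub 1).pow (k + 1)).sub
    (h.const_mul (2 * ((k : ℝ) + 1)))).div_const (2 * (k : ℝ) + 1)
  simp only [ne_eq, OfNat.ofNat_ne_zero, not_false_eq_true, zero_pow, sub_zero, one_pow,
    mul_zero] at hlim
  refine hlim.congr' ?_
  filter_upwards [eventually_gt_atTop 0] with r hr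
  have hk : 2 * (k : ℝ) + 1 ≠ 0 := by positivity
  have hpow : (1 - r⁻¹ ^ 2) ^ (k + 1) = (r ^ 2 - 1) ^ (k + 1) / r ^ (2 * (k + 1)) := by
    rw [pow_mul, ← div_pow]
    congr 1
    field_simp
  rw [hpow, ← Q_succ_add_Q k hr]
  field_simp
  ring

theorem tendsto_Q_div_pow_succ (k : ℕ) :
    Tendsto (fun r : ℝ => Q k r / r ^ (2 * (k + 1))) atTop (nhds 0) := by
  have hinv : Tendsto (fun r : ℝ => r⁻¹) atTop (nhds 0) := tendsto_inv_atTop_zero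
  induction k with
  | zero =>
    have hlim := hinv.sub (hinv.pow 2)
    simp only [ne_eq, OfNat.ofNat_ne_zero, not_false_eq_true, zero_pow, sub_zero] at hlim
    refine hlim.congr' ?_
    filter_upwards [eventually_gt_atTop 0] with r hr
    rw [Q_zero hr]
    field_simp
    ring
  | succ k ih =>
    have hlim := (tendsto_Q_succ_div_pow_of_tendsto k ih).mul (hinv.pow 2)
    simp only [ne_eq, OfNat.ofNat_ne_zero, not_false_eq_true, zero_pow, mul_zero] at hlim
    refine hlim.congr' ?_
    filter_upwards [eventually_gt_atTop 0] with r hr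
    field_simp
    ring

/-- The leading asymptotics `Q (k + 1) r ~ r ^ (2k + 2) / (2k + 1)`. -/
theorem tendsto_Q_succ_div_pow (k : ℕ) :
    Tendsto (fun r : ℝ => Q (k + 1) r / r ^ (2 * (k + 1))) atTop
      (nhds (1 / (2 * (k : ℝ) + 1))) :=
  tendsto_Q_succ_div_pow_of_tendsto k (tendsto_Q_div_pow_succ k)

theorem tendsto_pow_mul_Q_succ (k : ℕ) {t : ℝ} (ht : 0 < t) :
    Tendsto (fun c : ℝ => c ^ (k + 1) * Q (k + 1) (t / Real.sqrt c + 1))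
      (nhdsWithin 0 (Set.Ioi 0)) (nhds (t ^ (2 * (k + 1)) / (2 * (k : ℝ) + 1))) := by
  have hsqrt : Tendsto Real.sqrt (nhdsWithin 0 (Set.Ioi 0)) (nhds 0) := by
    simpa using (Real.continuous_sqrt.tendsto 0).mono_left nhdsWithin_le_nhds
  have hsqrt_pos : Tendsto Real.sqrt (nhdsWithin 0 (Set.Ioi 0)) (nhdsWithin 0 (Set.Ioi 0)) :=
    tendsto_nhdsWithin_iff.2 ⟨hsqrt, eventually_mem_nhdsWithin.mono fun c hc => Real.sqrt_pos.2 hc⟩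
  have hr : Tendsto (fun c : ℝ => t / Real.sqrt c + 1) (nhdsWithin 0 (Set.Ioi 0)) atTop :=
    tendsto_atTop_add_const_right _ _
      ((tendsto_inv_nhdsGT_zero.comp hsqrt_pos).const_mul_atTop ht)
  have hlim := ((hsqrt.const_add t).pow (2 * (k + 1))).mul ((tendsto_Q_succ_div_pow k).comp hr)
  rw [add_zero, mul_one_div] at hlim
  refine hlim.congr' ?_
  filter_upwards [self_mem_nhdsWithin] with c hc
  have hs : 0 < Real.sqrt c := Real.sqrt_pos.2 hc
  have hscale : (t + Real.sqrt c) ^ (2 * (k + 1))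
      = c ^ (k + 1) * (t / Real.sqrt c + 1) ^ (2 * (k + 1)) := by
    have hc' : c ^ (k + 1) = Real.sqrt c ^ (2 * (k + 1)) := by
      rw [pow_mul, Real.sq_sqrt (le_of_lt hc)]
    rw [hc', ← mul_pow]
    congr 1
    field_simp
  have hne : (t / Real.sqrt c + 1) ^ (2 * (k + 1)) ≠ 0 := by positivity
  rw [Function.comp_apply, hscale, mul_assoc, mul_div_cancel₀ _ hne]

/-- With `r_c = c^(-1/2)t + 1` and `b_n = 2n/(2n-3)`,
`c^n·P_{n,c}(r_c) → t^(2n) + b_n t^(2n-2)` as `c → 0⁺`. -/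
theorem stmt_16 (n : ℕ) (hn : 2 ≤ n) (t : ℝ) (ht : 0 < t)
    (b : ℝ) (hb : b = 2 * (n : ℝ) / (2 * (n : ℝ) - 3)) :
    Tendsto (fun c : ℝ => c ^ n * P n c (t / Real.sqrt c + 1))
      (nhdsWithin 0 (Set.Ioi 0))
      (nhds (t ^ (2 * n) + b * t ^ (2 * n - 2))) := by
  obtain ⟨m, rfl⟩ := Nat.exists_eq_add_of_le' hn
  have hm' : 2 * ((m + 1 : ℕ) : ℝ) + 1 ≠ 0 := by positivity
  have hlim := ((tendsto_pow_mul_Q_succ (m + 1) ht).const_mul (2 * ((m + 1 : ℕ) : ℝ) + 1)).add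
    ((tendsto_pow_mul_Q_succ m ht).const_mul (2 * ((m + 2 : ℕ) : ℝ)))
  have hval : t ^ (2 * (m + 2)) + b * t ^ (2 * (m + 2) - 2)
      = (2 * ((m + 1 : ℕ) : ℝ) + 1) * (t ^ (2 * (m + 1 + 1)) / (2 * ((m + 1 : ℕ) : ℝ) + 1))
        + 2 * ((m + 2 : ℕ) : ℝ) * (t ^ (2 * (m + 1)) / (2 * (m : ℝ) + 1)) := by
    have hb' : b = 2 * ((m + 2 : ℕ) : ℝ) / (2 * (m : ℝ) + 1) := by
      rw [hb]
      congr 1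
      push_cast
      ring
    rw [mul_div_cancel₀ _ hm', hb', show 2 * (m + 2) - 2 = 2 * (m + 1) by omega]
    ring
  rw [hval]
  refine hlim.congr' ?_
  filter_upwards [self_mem_nhdsWithin] with c hc
  have hc0 : c ≠ 0 := ne_of_gt hc
  rw [P, show m + 2 - 1 = m + 1 by omega]
  push_cast
  field_simp
  ring
end
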